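/- Assume the sphere assumption holds, n > 1, and y ∈ H_d is an optimal solution of the complex moment relaxation of order d ≥ d^min. Let d_K := max_{1≤i≤m} k_i and let t satisfy d^min ≤ t ≤ d. If (1) rank M_t(y) = rank M_{t−d_K}(y) =: S, and (2) for all 1 ≤ i < j ≤ n the 3×3 block matrix [[M_{t−d_K}(y), M_{t−d_K}(z̄_i y), M_{t−d_K}(z̄_j y)],[M_{t−d_K}(z_i y), M_{t−d_K}(|z_i|² y), M_{t−d_K}(z̄_j z_i y)],[M_{t−d_K}(z_j y), M_{t−d_K}(z̄_i z_j y), M_{t−d_K}(|z_j|² y)]] is positive semidefinite, then ρ_d = f^opt and the optimization problem inf_{z∈K} f(z) has at least S global solutions. -/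

import Mathlib

open scoped BigOperators ComplexOrder
open Classical Filter

noncomputable section

/-- Multi-indices in `ℕⁿ`. -/
abbrev MIdx (n : ℕ) := Fin n → ℕ

/-- `|α| = α₁ + ⋯ + αₙ`. -/
def mdeg {n : ℕ} (α : MIdx n) : ℕ := ∑ i, α i

/-- The monomial `z^α := z₁^{α₁} ⋯ zₙ^{αₙ}`. -/
def mpow {n : ℕ} (z : Fin n → ℂ) (α : MIdx n) : ℂ := ∏ i, z i ^ α i

/-- Evaluation of the coefficient array `c` as the (real part of the) complex
polynomial `z ↦ Σ_{α,β} c_{α,β} z̄^α z^β`. -/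
def peval {n : ℕ} (c : MIdx n → MIdx n → ℂ) (z : Fin n → ℂ) : ℝ :=
  (∑ᶠ α : MIdx n, ∑ᶠ β : MIdx n, c α β * (starRingEnd ℂ) (mpow z α) * mpow z β).re

/-- Evaluation of a holomorphic polynomial with coefficients `p`. -/
def hpeval {n : ℕ} (p : MIdx n → ℂ) (z : Fin n → ℂ) : ℂ :=
  ∑ᶠ α : MIdx n, p α * mpow z α

/-- `σ ∈ Σ_d[z]`: `σ` is a finite sum of squared moduli of holomorphic polynomials
of degree at most `d`. -/
def IsSOSUpTo {n : ℕ} (d : ℕ) (σ : (Fin n → ℂ) → ℝ) : Prop :=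
  ∃ (r : ℕ) (p : Fin r → MIdx n → ℂ),
    (∀ j α, p j α ≠ 0 → mdeg α ≤ d) ∧
    ∀ z, σ z = ∑ j, Complex.normSq (hpeval (p j) z)

/-- `σ ∈ Σ[z]`. -/
def IsSOS {n : ℕ} (σ : (Fin n → ℂ) → ℝ) : Prop := ∃ d, IsSOSUpTo d σ

/-- Hermitian coefficient array of degree at most `l` (real-valued complex polynomial). -/
def IsPolyDeg {n : ℕ} (l : ℕ) (c : MIdx n → MIdx n → ℂ) : Prop :=
  (∀ α β, c α β ≠ 0 → mdeg α ≤ l ∧ mdeg β ≤ l) ∧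
  (∀ α β, (starRingEnd ℂ) (c α β) = c β α)

/-- `c` has a nonzero coefficient `c_{α,β}` with `|α| = l` (degree exactly `l`). -/
def HasTopDeg {n : ℕ} (l : ℕ) (c : MIdx n → MIdx n → ℂ) : Prop :=
  ∃ α β, mdeg α = l ∧ mdeg β ≤ l ∧ c α β ≠ 0

/-- Multi-indices of degree at most `e`, indexing moment matrices. -/
def Idx (n e : ℕ) := {α : MIdx n // mdeg α ≤ e}

noncomputable instance {n e : ℕ} : Fintype (Idx n e) :=
  Fintype.ofInjective
    (fun a : Idx n e => (fun i =>
      (⟨a.1 i, Nat.lt_succ_of_le (le_trans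
        (Finset.single_le_sum (f := a.1) (fun j _ => Nat.zero_le _) (Finset.mem_univ i))
        a.2)⟩ : Fin (e + 1)) : Fin n → Fin (e + 1)))
    (fun a b h => Subtype.ext (funext fun i => congrArg Fin.val (congrFun h i)))

/-- Entry `(α,β)` of the localizing matrix `M(φ y)`:
`Σ_{γ,δ} φ_{γ,δ} y_{α+γ, β+δ}`. -/
def momEntry {n : ℕ} (φ y : MIdx n → MIdx n → ℂ) (α β : MIdx n) : ℂ :=
  ∑ᶠ γ : MIdx n, ∑ᶠ δ : MIdx n, φ γ δ * y (α + γ) (β + δ)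

/-- The localizing matrix `M_e(φ y)` indexed by multi-indices of degree at most `e`. -/
def momMatrix (n e : ℕ) (φ y : MIdx n → MIdx n → ℂ) :
    Matrix (Idx n e) (Idx n e) ℂ :=
  Matrix.of fun a b => momEntry φ y a.1 b.1

/-- The moment matrix `M_e(y)` indexed by multi-indices of degree at most `e`. -/
def momMatrixId (n e : ℕ) (y : MIdx n → MIdx n → ℂ) :
    Matrix (Idx n e) (Idx n e) ℂ :=
  Matrix.of fun a b => y a.1 b.1

/-- The Riesz functional `L_y(c) = Σ_{α,β} c_{α,β} y_{α,β}` (real part). -/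
def Ly {n : ℕ} (c y : MIdx n → MIdx n → ℂ) : ℝ :=
  (∑ᶠ α : MIdx n, ∑ᶠ β : MIdx n, c α β * y α β).re

/-- `y ∈ H_d`: hermitian array truncated at degree `d`. -/
def HermArr (n d : ℕ) (y : MIdx n → MIdx n → ℂ) : Prop :=
  ∀ α β : MIdx n, mdeg α ≤ d → mdeg β ≤ d → (starRingEnd ℂ) (y α β) = y β α

/-- The feasible set `K = {z : g_i(z) ≥ 0, i = 1,…,m}`. -/
def Kset {n m : ℕ} (g : Fin m → MIdx n → MIdx n → ℂ) : Set (Fin n → ℂ) :=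
  {z | ∀ i, 0 ≤ peval (g i) z}

/-- Coefficients of the polynomial `s(z) = R² − |z₁|² − ⋯ − |zₙ|²`. -/
def spherePoly (n : ℕ) (R : ℝ) : MIdx n → MIdx n → ℂ := fun α β =>
  if α = 0 ∧ β = 0 then ((R ^ 2 : ℝ) : ℂ)
  else if ∃ i : Fin n, α = Pi.single i 1 ∧ β = Pi.single i 1 then -1 else 0

/-- Feasibility for the complex moment relaxation of order `d`. -/
def MomFeas (n m d : ℕ) (g : Fin m → MIdx n → MIdx n → ℂ) (kk : Fin m → ℕ)
    (y : MIdx n → MIdx n → ℂ) : Prop :=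
  HermArr n d y ∧ y 0 0 = 1 ∧ (momMatrixId n d y).PosSemidef ∧
    ∀ i, (momMatrix n (d - kk i) (g i) y).PosSemidef

/-- `ρ_d`: optimal value of the complex moment relaxation of order `d`. -/
def rhoMom (n m d : ℕ) (f : MIdx n → MIdx n → ℂ) (g : Fin m → MIdx n → MIdx n → ℂ)
    (kk : Fin m → ℕ) : EReal :=
  sInf {x : EReal | ∃ y, MomFeas n m d g kk y ∧ x = ((Ly f y : ℝ) : EReal)}

/-- A degree-`d` sum-of-squares certificate `f − λ = Σ_{i=0}^m σ_i g_i`. -/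
def SOSCert (n m d : ℕ) (f : MIdx n → MIdx n → ℂ) (g : Fin m → MIdx n → MIdx n → ℂ)
    (kk : Fin m → ℕ) (lam : ℝ) : Prop :=
  ∃ (σ0 : (Fin n → ℂ) → ℝ) (σ : Fin m → (Fin n → ℂ) → ℝ),
    IsSOSUpTo d σ0 ∧ (∀ i, IsSOSUpTo (d - kk i) (σ i)) ∧
    ∀ z, peval f z - lam = σ0 z + ∑ i, σ i z * peval (g i) z

/-- `ρ_d*`: optimal value of the complex sum-of-squares relaxation of order `d`. -/
def rhoSOS (n m d : ℕ) (f : MIdx n → MIdx n → ℂ) (g : Fin m → MIdx n → MIdx n → ℂ)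
    (kk : Fin m → ℕ) : EReal :=
  sSup {x : EReal | ∃ lam : ℝ, SOSCert n m d f g kk lam ∧ x = ((lam : ℝ) : EReal)}

/-- `f^opt = inf_K f` as an extended real number. -/
def fOpt (n m : ℕ) (f : MIdx n → MIdx n → ℂ) (g : Fin m → MIdx n → MIdx n → ℂ) : EReal :=
  sInf {x : EReal | ∃ z ∈ Kset g, x = ((peval f z : ℝ) : EReal)}

/-- Sphere assumption: two of the constraint polynomials are `s` and `−s` where
`s(z) = R² − |z₁|² − ⋯ − |zₙ|²`. -/
def SphereAssumption (n m : ℕ) (g : Fin m → MIdx n → MIdx n → ℂ) (R : ℝ) : Prop :=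
  0 < R ∧ ∃ i₁ i₂ : Fin m, i₁ ≠ i₂ ∧ g i₁ = spherePoly n R ∧
    (∀ α β, g i₂ α β = -(spherePoly n R α β))

/-- The 3×3 block matrix
`[[M_e(y), M_e(z̄_i y), M_e(z̄_j y)],
  [M_e(z_i y), M_e(|z_i|² y), M_e(z̄_j z_i y)],
  [M_e(z_j y), M_e(z̄_i z_j y), M_e(|z_j|² y)]]`. -/
def locMat3 (n e : ℕ) (y : MIdx n → MIdx n → ℂ) (i j : Fin n) :
    Matrix (Fin 3 × Idx n e) (Fin 3 × Idx n e) ℂ :=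
  Matrix.of fun a b =>
    y (a.2.1 + ![0, Pi.single i 1, Pi.single j 1] b.1)
      (b.2.1 + ![0, Pi.single i 1, Pi.single j 1] a.1)

open LinearMap in
lemma hypo_normal {H : Type*} [NormedAddCommGroup H] [InnerProductSpace ℂ H]
    [FiniteDimensional ℂ H] (T : H →ₗ[ℂ] H)
    (h : ∀ x, ‖LinearMap.adjoint T x‖ ^ 2 ≤ ‖T x‖ ^ 2) :
    LinearMap.adjoint T * T = T * LinearMap.adjoint T := by
  set D : H →ₗ[ℂ] H := LinearMap.adjoint T * T - T * LinearMap.adjoint T with hD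
  have hin : ∀ x, inner ℂ x (D x) = ((‖T x‖ ^ 2 - ‖LinearMap.adjoint T x‖ ^ 2 : ℝ) : ℂ) := by
    intro x
    simp only [hD, LinearMap.sub_apply, Module.End.mul_apply, inner_sub_right]
    rw [LinearMap.adjoint_inner_right, ← LinearMap.adjoint_inner_left T (LinearMap.adjoint T x) x,
      inner_self_eq_norm_sq_to_K, inner_self_eq_norm_sq_to_K]
    simp
  have hsym : D.IsSymmetric := by
    intro x z
    simp only [hD, LinearMap.sub_apply, Module.End.mul_apply, inner_sub_right, inner_sub_left,
      LinearMap.adjoint_inner_right, LinearMap.adjoint_inner_left]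
    rw [← LinearMap.adjoint_inner_right T (LinearMap.adjoint T x) z,
      ← LinearMap.adjoint_inner_left T (LinearMap.adjoint T z) x]
  have htr : LinearMap.trace ℂ H D = 0 := by
    rw [hD, map_sub, LinearMap.trace_mul_comm, sub_self]
  let b := hsym.eigenvectorBasis (n := Module.finrank ℂ H) rfl
  rw [LinearMap.trace_eq_sum_inner D b] at htr
  have h0 : ∀ i, inner ℂ (b i) (D (b i)) = 0 := by
    have hs : ∑ i, (‖T (b i)‖ ^ 2 - ‖LinearMap.adjoint T (b i)‖ ^ 2) = 0 := by
      simp only [hin] at htr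
      exact_mod_cast htr
    rw [Finset.sum_eq_zero_iff_of_nonneg (fun i _ => sub_nonneg.2 (h _))] at hs
    intro i
    rw [hin, hs i (Finset.mem_univ _)]; simp
  have hD0 : D = 0 := by
    refine b.toBasis.ext fun i => ?_
    have h1 : D (b i) = _ • b i := hsym.apply_eigenvectorBasis (n := Module.finrank ℂ H) rfl i
    have h2 := h0 i
    rw [h1, inner_smul_right, inner_self_eq_norm_sq_to_K, b.orthonormal.1] at h2
    simp only [map_one, one_pow, mul_one] at h2
    simp only [OrthonormalBasis.coe_toBasis, LinearMap.zero_apply]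
    rw [h1]
    simpa using Or.inl h2
  exact sub_eq_zero.1 hD0

lemma zero_of_trace {H : Type*} [NormedAddCommGroup H] [InnerProductSpace ℂ H]
    [FiniteDimensional ℂ H] (C : H →ₗ[ℂ] H)
    (h : LinearMap.trace ℂ H (LinearMap.adjoint C * C) = 0) : C = 0 := by
  let b := stdOrthonormalBasis ℂ H
  rw [LinearMap.trace_eq_sum_inner _ b] at h
  have hs : ∑ i, ‖C (b i)‖ ^ 2 = 0 := by
    have : ∀ i, inner ℂ (b i) ((LinearMap.adjoint C * C) (b i)) = ((‖C (b i)‖ ^ 2 : ℝ) : ℂ) := by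
      intro i
      rw [Module.End.mul_apply, LinearMap.adjoint_inner_right, inner_self_eq_norm_sq_to_K]
      simp
    simp only [this] at h
    exact_mod_cast h
  rw [Finset.sum_eq_zero_iff_of_nonneg (fun i _ => by positivity)] at hs
  refine b.toBasis.ext fun i => ?_
  simpa using hs i (Finset.mem_univ _)

lemma fuglede_fin {H : Type*} [NormedAddCommGroup H] [InnerProductSpace ℂ H]
    [FiniteDimensional ℂ H] (A B : H →ₗ[ℂ] H)
    (hB : LinearMap.adjoint B * B = B * LinearMap.adjoint B)
    (hAB : LinearMap.adjoint B * A = A * LinearMap.adjoint B) : A * B = B * A := by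
  have hadj : ∀ X Y : H →ₗ[ℂ] H, LinearMap.adjoint (X * Y) =
    LinearMap.adjoint Y * LinearMap.adjoint X := fun X Y => LinearMap.adjoint_comp X Y
  have hAB' : LinearMap.adjoint A * B = B * LinearMap.adjoint A := by
    have := congrArg LinearMap.adjoint hAB
    rwa [hadj, hadj, LinearMap.adjoint_adjoint] at this
  refine sub_eq_zero.1 (zero_of_trace _ ?_)
  rw [map_sub, hadj, hadj]
  set A' := LinearMap.adjoint A
  set B' := LinearMap.adjoint B
  have e1 : LinearMap.trace ℂ H (B' * A' * (A * B)) = LinearMap.trace ℂ H (B' * B * (A' * A)) := by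
    rw [← mul_assoc, LinearMap.trace_mul_comm, hB]; simp only [mul_assoc]
  have e2 : B' * A' * (B * A) = B' * B * (A' * A) := by
    rw [mul_assoc, ← mul_assoc A', hAB']; simp only [mul_assoc]
  have e3 : LinearMap.trace ℂ H (A' * B' * (A * B)) = LinearMap.trace ℂ H (B' * B * (A' * A)) := by
    rw [mul_assoc, ← mul_assoc B', hAB, LinearMap.trace_mul_comm (R := ℂ) (M := H) (B' * B)]
    simp only [mul_assoc]
  have e4 : LinearMap.trace ℂ H (A' * B' * (B * A)) = LinearMap.trace ℂ H (B' * B * (A' * A)) := by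
    have : A' * B' * (B * A) = B * A' * A * B' := by
      rw [← hAB', mul_assoc A' B', ← mul_assoc B', hB, mul_assoc B, hAB]
      simp only [mul_assoc]
    rw [this, LinearMap.trace_mul_comm]; simp only [mul_assoc]
  simp only [sub_mul, mul_sub, map_sub, e1, e2, e3, e4]
  simp

open LinearMap in
lemma joint_basis {n : ℕ} {H : Type*} [NormedAddCommGroup H] [InnerProductSpace ℂ H]
    [FiniteDimensional ℂ H] (T : Fin n → H →ₗ[ℂ] H)
    (h1 : ∀ i j, T i * T j = T j * T i)
    (h2 : ∀ i j, LinearMap.adjoint (T i) * T j = T j * LinearMap.adjoint (T i)) :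
    ∃ b : OrthonormalBasis (Fin (Module.finrank ℂ H)) ℂ H,
    ∃ ζ : Fin (Module.finrank ℂ H) → Fin n → ℂ, ∀ s i, T i (b s) = ζ s i • b s := by
  have hadj : ∀ X Y : H →ₗ[ℂ] H, LinearMap.adjoint (X * Y) =
    LinearMap.adjoint Y * LinearMap.adjoint X := fun X Y => LinearMap.adjoint_comp X Y
  have h3 : ∀ i j, LinearMap.adjoint (T i) * LinearMap.adjoint (T j) =
      LinearMap.adjoint (T j) * LinearMap.adjoint (T i) := by
    intro i j
    rw [← hadj, ← hadj, h1]
  let A : Fin n ⊕ Fin n → H →ₗ[ℂ] H := Sum.elim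
    (fun i => T i + LinearMap.adjoint (T i))
    (fun i => Complex.I • (T i - LinearMap.adjoint (T i)))
  have hA : ∀ i, (A i).IsSymmetric := by
    rintro (i | i) x z
    · simp [A, inner_add_left, inner_add_right, LinearMap.adjoint_inner_left,
        LinearMap.adjoint_inner_right, add_comm]
    · simp [A, inner_sub_left, inner_sub_right, LinearMap.adjoint_inner_left,
        LinearMap.adjoint_inner_right, inner_smul_left, inner_smul_right]
      ring
  have hC : Pairwise (Function.onFun Commute A) := by
    have c1 : ∀ i j, Commute (T i) (T j) := h1
    have c2 : ∀ i j, Commute (LinearMap.adjoint (T i)) (T j) := h2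
    have c3 : ∀ i j, Commute (LinearMap.adjoint (T i)) (LinearMap.adjoint (T j)) := h3
    have c4 : ∀ i j, Commute (T i) (LinearMap.adjoint (T j)) := fun i j => (c2 j i).symm
    rintro (i | i) (j | j) -
    · exact ((c1 i j).add_right (c4 i j)).add_left ((c2 i j).add_right (c3 i j))
    · exact (((c1 i j).sub_right (c4 i j)).add_left ((c2 i j).sub_right (c3 i j))).smul_right _
    · exact (((c1 i j).add_right (c4 i j)).sub_left ((c2 i j).add_right (c3 i j))).smul_left _
    · exact ((((c1 i j).sub_right (c4 i j)).sub_left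
        ((c2 i j).sub_right (c3 i j))).smul_left _).smul_right _
  have hint := LinearMap.IsSymmetric.directSum_isInternal_of_pairwise_commute hA hC
  have hof := LinearMap.IsSymmetric.orthogonalFamily_iInf_eigenspaces hA
  let bb := hint.collectedBasis (fun χ => (stdOrthonormalBasis ℂ
      (⨅ j, Module.End.eigenspace (A j) (χ j) : Submodule ℂ H)).toBasis)
  have hbo : Orthonormal ℂ bb := hint.collectedBasis_orthonormal hof (by
    intro χ
    simp)
  have hfin : Finite (Σ χ : (Fin n ⊕ Fin n → ℂ), Fin (Module.finrank ℂ
      (⨅ j, Module.End.eigenspace (A j) (χ j) : Submodule ℂ H))) := Module.Finite.finite_basis bb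
  have := Fintype.ofFinite (Σ χ : (Fin n ⊕ Fin n → ℂ), Fin (Module.finrank ℂ
      (⨅ j, Module.End.eigenspace (A j) (χ j) : Submodule ℂ H)))
  have hcard := Module.finrank_eq_card_basis bb
  let eqv := (Fintype.equivFinOfCardEq hcard.symm)
  let b := (bb.toOrthonormalBasis hbo).reindex eqv
  have hb : ∀ s, b s = bb (eqv.symm s) := by intro s; simp [b]
  refine ⟨b, fun s i => ((eqv.symm s).1 (Sum.inl i) - Complex.I * (eqv.symm s).1 (Sum.inr i)) / 2, ?_⟩
  intro s i
  have hmem : b s ∈ (⨅ j, Module.End.eigenspace (A j) ((eqv.symm s).1 j) : Submodule ℂ H) := by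
    rw [hb]
    exact hint.collectedBasis_mem _ _
  rw [Submodule.mem_iInf] at hmem
  have m1 := Module.End.mem_eigenspace_iff.1 (hmem (Sum.inl i))
  have m2 := Module.End.mem_eigenspace_iff.1 (hmem (Sum.inr i))
  simp only [A, Sum.elim_inl, Sum.elim_inr, LinearMap.add_apply, LinearMap.smul_apply,
    LinearMap.sub_apply] at m1 m2
  have : T i (b s) = (1 / 2 : ℂ) • ((T i (b s) + LinearMap.adjoint (T i) (b s)) -
    Complex.I • (Complex.I • (T i (b s) - LinearMap.adjoint (T i) (b s)))) := by
    rw [smul_smul, Complex.I_mul_I]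
    module
  rw [this, m1, m2]
  module

lemma mdeg_add {n : ℕ} (α β : MIdx n) : mdeg (α + β) = mdeg α + mdeg β := by
  simp [mdeg, Finset.sum_add_distrib]

lemma mdeg_single {n : ℕ} (i : Fin n) : mdeg (Pi.single i 1 : MIdx n) = 1 := by
  simp [mdeg]

lemma mdeg_zero {n : ℕ} : mdeg (0 : MIdx n) = 0 := by
  simp [mdeg]

lemma mpow_add {n : ℕ} (z : Fin n → ℂ) (α β : MIdx n) :
    mpow z (α + β) = mpow z α * mpow z β := by
  simp [mpow, pow_add, Finset.prod_mul_distrib]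

lemma mpow_zero {n : ℕ} (z : Fin n → ℂ) : mpow z 0 = 1 := by
  simp [mpow]

lemma mpow_single {n : ℕ} (z : Fin n → ℂ) (i : Fin n) : mpow z (Pi.single i 1) = z i := by
  rw [mpow, Finset.prod_eq_single i]
  · simp
  · intro j _ hj; simp [hj]
  · simp

lemma exists_shift {n : ℕ} {t : ℕ} {H : Type*} [NormedAddCommGroup H] [InnerProductSpace ℂ H]
    [FiniteDimensional ℂ H] (R : ℝ) (u : MIdx n → H)
    (hspan : Submodule.span ℂ (Set.range fun a : Idx n t => u a.1) = ⊤)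
    (hsph : ∀ (c : Idx n t → ℂ) (i : Fin n),
      ‖∑ a, c a • u (a.1 + Pi.single i 1)‖ ^ 2 ≤ R ^ 2 * ‖∑ a, c a • u a.1‖ ^ 2) (i : Fin n) :
    ∃ T : H →ₗ[ℂ] H, ∀ α, mdeg α ≤ t → T (u α) = u (α + Pi.single i 1) := by
  let A := Fintype.linearCombination ℂ (fun a : Idx n t => u a.1)
  let C := Fintype.linearCombination ℂ (fun a : Idx n t => u (a.1 + Pi.single i 1))
  have hA : LinearMap.range A = ⊤ := by
    rw [Fintype.range_linearCombination, hspan]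
  obtain ⟨B, hB⟩ := A.exists_rightInverse_of_surjective hA
  have hker : ∀ c, A c = 0 → C c = 0 := by
    intro c hc
    have := hsph c i
    have h1 : ∑ a, c a • u a.1 = 0 := by
      rw [← hc]; simp [A, Fintype.linearCombination_apply]
    rw [h1] at this
    have h2 : ‖∑ a, c a • u (a.1 + Pi.single i 1)‖ ^ 2 = 0 :=
      le_antisymm (by simpa using this) (by positivity)
    have h3 : ∑ a, c a • u (a.1 + Pi.single i 1) = 0 := by simpa using h2
    rw [← h3]; simp [C, Fintype.linearCombination_apply]
  refine ⟨C ∘ₗ B, fun α hα => ?_⟩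
  have h1 : A (Pi.single ⟨α, hα⟩ 1) = u α := by
    exact (Fintype.linearCombination_apply_single ℂ _ _ _).trans (one_smul _ _)
  have h2 : C (Pi.single ⟨α, hα⟩ 1) = u (α + Pi.single i 1) := by
    exact (Fintype.linearCombination_apply_single ℂ _ _ _).trans (one_smul _ _)
  rw [← h1, ← h2, LinearMap.comp_apply, ← sub_eq_zero, ← map_sub]
  apply hker
  rw [map_sub, sub_eq_zero]
  exact LinearMap.congr_fun hB _

lemma hypo_comm {n : ℕ} (hn : 1 < n) {H : Type*} [NormedAddCommGroup H] [InnerProductSpace ℂ H]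
    [FiniteDimensional ℂ H] (T : Fin n → H →ₗ[ℂ] H)
    (key : ∀ i j, i < j → ∀ p : Fin 3 → H,
      0 ≤ ∑ a : Fin 3, ∑ b : Fin 3, inner ℂ ((![1, T i, T j] : Fin 3 → H →ₗ[ℂ] H) b (p a))
        ((![1, T i, T j] : Fin 3 → H →ₗ[ℂ] H) a (p b))) :
    (∀ i j, T i * T j = T j * T i) ∧
    (∀ i j, LinearMap.adjoint (T i) * T j = T j * LinearMap.adjoint (T i)) := by
  have key2 : ∀ i j, i < j → ∀ x z, ‖LinearMap.adjoint (T i) x + LinearMap.adjoint (T j) z‖ ^ 2 ≤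
      ‖T i x‖ ^ 2 + ‖T j z‖ ^ 2 + 2 * (inner ℂ (T j x) (T i z)).re := by
    intro i j hij x z
    set w := LinearMap.adjoint (T i) x + LinearMap.adjoint (T j) z with hw
    have h := key i j hij ![-w, x, z]
    simp only [Fin.sum_univ_three, Matrix.cons_val_zero, Matrix.cons_val_one, Matrix.cons_val,
      Module.End.one_apply, map_neg, inner_neg_left, inner_neg_right, neg_neg] at h
    have e1 : inner ℂ (T i w) x = inner ℂ w (LinearMap.adjoint (T i) x) := by
      rw [LinearMap.adjoint_inner_right]
    have e2 : inner ℂ (T j w) z = inner ℂ w (LinearMap.adjoint (T j) z) := by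
      rw [LinearMap.adjoint_inner_right]
    have e3 : inner ℂ x (T i w) = inner ℂ (LinearMap.adjoint (T i) x) w := by
      rw [LinearMap.adjoint_inner_left]
    have e4 : inner ℂ z (T j w) = inner ℂ (LinearMap.adjoint (T j) z) w := by
      rw [LinearMap.adjoint_inner_left]
    have e5 : inner ℂ w w = inner ℂ w (LinearMap.adjoint (T i) x) +
      inner ℂ w (LinearMap.adjoint (T j) z) := by rw [← inner_add_right]
    have e6 : inner ℂ w w = inner ℂ (LinearMap.adjoint (T i) x) w +
      inner ℂ (LinearMap.adjoint (T j) z) w := by rw [← inner_add_left]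
    have e7 : (inner ℂ (T i z) (T j x)).re = (inner ℂ (T j x) (T i z)).re := by
      rw [← inner_conj_symm, Complex.conj_re]
    have nn : ∀ v : H, (inner ℂ v v).re = ‖v‖ ^ 2 := by
      intro v; rw [inner_self_eq_norm_sq_to_K]; norm_cast
    have h' := (Complex.le_def.1 h).1
    rw [e1, e2, e3, e4] at h'
    have e5' := congrArg Complex.re e5
    have e6' := congrArg Complex.re e6
    simp only [Complex.add_re, Complex.neg_re, Complex.zero_re, nn] at h' e5' e6'
    linarith
  have hnorm : ∀ i, LinearMap.adjoint (T i) * T i = T i * LinearMap.adjoint (T i) := by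
    intro i
    apply hypo_normal
    intro x
    by_cases hi : i.1 + 1 < n
    · simpa using key2 i ⟨i.1 + 1, hi⟩ (Fin.lt_def.2 (by simp)) x 0
    · simpa using key2 ⟨0, by omega⟩ i (Fin.lt_def.2 (by simp; omega)) 0 x
  have nneq : ∀ i x, ‖LinearMap.adjoint (T i) x‖ ^ 2 = ‖T i x‖ ^ 2 := by
    intro i x
    have : inner ℂ (LinearMap.adjoint (T i) x) (LinearMap.adjoint (T i) x) =
        inner ℂ (T i x) (T i x) := by
      rw [LinearMap.adjoint_inner_left, ← LinearMap.adjoint_inner_right, ← Module.End.mul_apply,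
        ← Module.End.mul_apply, hnorm]
    rw [inner_self_eq_norm_sq_to_K, inner_self_eq_norm_sq_to_K] at this
    exact_mod_cast this
  have hlt : ∀ i j, i < j → LinearMap.adjoint (T j) * T i = T i * LinearMap.adjoint (T j) := by
    intro i j hij
    ext z
    simp only [Module.End.mul_apply]
    set x := T i (LinearMap.adjoint (T j) z) - LinearMap.adjoint (T j) (T i z) with hx
    have h := key2 i j hij x z
    have := @norm_add_sq ℂ H _ _ _ (LinearMap.adjoint (T i) x) (LinearMap.adjoint (T j) z)
    rw [this, nneq, nneq] at h
    have e1 : inner ℂ (LinearMap.adjoint (T i) x) (LinearMap.adjoint (T j) z) =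
      inner ℂ x (T i (LinearMap.adjoint (T j) z)) := by rw [LinearMap.adjoint_inner_left]
    have e2 : inner ℂ (T j x) (T i z) =
      inner ℂ x (LinearMap.adjoint (T j) (T i z)) := by rw [LinearMap.adjoint_inner_right]
    have e3 : inner ℂ x x = inner ℂ x (T i (LinearMap.adjoint (T j) z)) -
       inner ℂ x (LinearMap.adjoint (T j) (T i z)) := by rw [← inner_sub_right]
    rw [e1, e2] at h
    have e3' := congrArg Complex.re e3
    rw [inner_self_eq_norm_sq_to_K] at e3'
    have e4 : (((‖x‖ : ℂ)) ^ 2).re = ‖x‖ ^ 2 := by norm_cast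
    simp only [Complex.sub_re] at e3'
    have e5 : ‖x‖ ^ 2 ≤ 0 := by
      erw [e4] at e3'
      simp only [RCLike.re_to_complex] at h
      linarith
    have e6 : x = 0 := by
      have : ‖x‖ ^ 2 = 0 := le_antisymm e5 (by positivity)
      simpa using this
    exact (sub_eq_zero.1 e6).symm
  have hadj : ∀ X Y : H →ₗ[ℂ] H, LinearMap.adjoint (X * Y) =
    LinearMap.adjoint Y * LinearMap.adjoint X := fun X Y => LinearMap.adjoint_comp X Y
  have h2 : ∀ i j, LinearMap.adjoint (T i) * T j = T j * LinearMap.adjoint (T i) := by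
    intro i j
    rcases lt_trichotomy i j with h | h | h
    · have := congrArg LinearMap.adjoint (hlt i j h)
      rwa [hadj, hadj, LinearMap.adjoint_adjoint] at this
    · subst h; exact hnorm i
    · exact hlt j i h
  exact ⟨fun i j => fuglede_fin _ _ (hnorm j) (h2 j i), h2⟩

lemma atomic_rep {n : ℕ} (hn : 1 < n) {t e : ℕ} (het : e ≤ t) {H : Type*}
    [NormedAddCommGroup H] [InnerProductSpace ℂ H]
    [FiniteDimensional ℂ H] (R : ℝ) (u : MIdx n → H)
    (hspan : Submodule.span ℂ (Set.range fun a : Idx n e => u a.1) = ⊤)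
    (hsph : ∀ (c : Idx n t → ℂ) (i : Fin n),
      ‖∑ a, c a • u (a.1 + Pi.single i 1)‖ ^ 2 ≤ R ^ 2 * ‖∑ a, c a • u a.1‖ ^ 2)
    (hloc : ∀ i j : Fin n, i < j → ∀ c : Fin 3 × Idx n e → ℂ,
      0 ≤ ∑ a, ∑ b, star (c a) *
        inner ℂ (u (a.2.1 + (![0, Pi.single i 1, Pi.single j 1] : Fin 3 → MIdx n) b.1))
          (u (b.2.1 + (![0, Pi.single i 1, Pi.single j 1] : Fin 3 → MIdx n) a.1)) * c b) :
    ∃ b : OrthonormalBasis (Fin (Module.finrank ℂ H)) ℂ H,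
    ∃ ζ : Fin (Module.finrank ℂ H) → Fin n → ℂ, ∀ s α, mdeg α ≤ t + 1 →
      inner ℂ (b s) (u α) = mpow (ζ s) α * inner ℂ (b s) (u 0) := by
  have hspan' : Submodule.span ℂ (Set.range fun a : Idx n t => u a.1) = ⊤ := by
    rw [eq_top_iff, ← hspan]
    apply Submodule.span_mono
    rintro _ ⟨a, rfl⟩
    exact ⟨⟨a.1, a.2.trans het⟩, rfl⟩
  choose T hT using exists_shift R u hspan' hsph
  have hS : ∀ i j (b : Fin 3) (α : Idx n e), (![1, T i, T j] : Fin 3 → H →ₗ[ℂ] H) b (u α.1) =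
      u (α.1 + (![0, Pi.single i 1, Pi.single j 1] : Fin 3 → MIdx n) b) := by
    intro i j b α
    fin_cases b
    · simp
    · simpa using hT i α.1 (α.2.trans het)
    · simpa using hT j α.1 (α.2.trans het)
  obtain ⟨h1, h2⟩ := hypo_comm hn T (by
    intro i j hij p
    have hp : ∀ a, ∃ c : Idx n e → ℂ, ∑ α, c α • u α.1 = p a := by
      intro a
      have : p a ∈ Submodule.span ℂ (Set.range fun a : Idx n e => u a.1) := by
        rw [hspan]; trivial
      rwa [Submodule.mem_span_range_iff_exists_fun] at this
    choose c hc using hp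
    have h := hloc i j hij (fun a => c a.1 a.2)
    convert h using 1
    simp only [Fintype.sum_prod_type]
    refine Finset.sum_congr rfl fun a _ => ?_
    rw [Finset.sum_comm]
    refine Finset.sum_congr rfl fun b _ => ?_
    rw [← hc a, ← hc b]
    simp only [map_sum, map_smul, hS, sum_inner, inner_sum, inner_smul_left, inner_smul_right]
    simp only [Finset.mul_sum]
    rw [Finset.sum_comm]
    refine Finset.sum_congr rfl fun α _ => ?_
    refine Finset.sum_congr rfl fun β _ => ?_
    rw [← starRingEnd_apply]
    ring)
  obtain ⟨b, ζ, hb⟩ := joint_basis T h1 h2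
  refine ⟨b, ζ, ?_⟩
  have hin : ∀ s i v, inner ℂ (b s) (T i v) = ζ s i * inner ℂ (b s) v := by
    intro s i v
    conv_lhs => rw [← b.sum_repr' v]
    simp only [map_sum, map_smul, hb, inner_sum, inner_smul_right]
    rw [Finset.sum_eq_single s]
    · rw [b.inner_eq_one]; ring
    · intro r _ hr
      rw [b.inner_eq_zero hr.symm]; ring
    · simp
  intro s
  have : ∀ N α, mdeg α = N → N ≤ t + 1 →
      inner ℂ (b s) (u α) = mpow (ζ s) α * inner ℂ (b s) (u 0) := by
    intro N
    induction N with
    | zero =>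
      intro α hα _
      have : α = 0 := by
        funext i
        simp only [mdeg, Finset.sum_eq_zero_iff] at hα
        exact hα i (Finset.mem_univ _)
      subst this
      rw [mpow_zero, one_mul]
    | succ N ih =>
      intro α hα hN
      obtain ⟨i, hi⟩ : ∃ i, α i ≠ 0 := by
        by_contra hcon
        push Not at hcon
        simp [mdeg, hcon] at hα
      obtain ⟨β, hβ⟩ : ∃ β : MIdx n, α = β + Pi.single i 1 := by
        refine ⟨α - Pi.single i 1, ?_⟩
        funext k
        by_cases hk : k = i
        · subst hk; simp; omega
        · simp [hk]
      subst hβ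
      rw [mdeg_add, mdeg_single] at hα
      rw [← hT i β (by omega), hin, ih β (by omega) (by omega), mpow_add, mpow_single]
      ring
  exact fun α hα => this _ α rfl hα

open scoped MatrixOrder in
lemma psd_factor {ι : Type*} [Fintype ι] (M : Matrix ι ι ℂ) (hM : M.PosSemidef) :
    ∃ u : ι → EuclideanSpace ℂ ι, ∀ a b, inner ℂ (u a) (u b) = M a b := by
  obtain ⟨B, hB⟩ := CStarAlgebra.nonneg_iff_eq_star_mul_self.mp hM.nonneg
  refine ⟨fun a => WithLp.toLp 2 (fun i => B i a), fun a b => ?_⟩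
  rw [hB]
  simp [Matrix.mul_apply, PiLp.inner_apply, Matrix.star_apply, mul_comm]

lemma rank_gram {ι E : Type*} [Fintype ι] [NormedAddCommGroup E] [InnerProductSpace ℂ E]
    [FiniteDimensional ℂ E] (u : ι → E) (M : Matrix ι ι ℂ)
    (hM : ∀ a b, inner ℂ (u a) (u b) = M a b) :
    M.rank = Module.finrank ℂ (Submodule.span ℂ (Set.range u)) := by
  let b := stdOrthonormalBasis ℂ E
  let A : Matrix (Fin (Module.finrank ℂ E)) ι ℂ := Matrix.of fun i a => b.repr (u a) i
  have hA : M = A.conjTranspose * A := by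
    ext a c
    rw [← hM, ← b.sum_inner_mul_inner]
    simp [Matrix.mul_apply, A, b.repr_apply_apply]
  rw [hA, Matrix.rank_conjTranspose_mul_self, Matrix.rank_eq_finrank_span_cols]
  let L : E ≃ₗ[ℂ] (Fin (Module.finrank ℂ E) → ℂ) :=
    b.repr.toLinearEquiv ≪≫ₗ WithLp.linearEquiv 2 ℂ (Fin (Module.finrank ℂ E) → ℂ)
  have : Set.range A.col = (L : E →ₗ[ℂ] _) '' Set.range u := by
    rw [← Set.range_comp]
    rfl
  rw [this, Submodule.span_image]
  exact LinearEquiv.finrank_map_eq L _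

lemma exists_gns {n t e : ℕ} (het : e ≤ t) (y : MIdx n → MIdx n → ℂ)
    (hM : (momMatrixId n t y).PosSemidef)
    (hrank : (momMatrixId n t y).rank = (momMatrixId n e y).rank) :
    ∃ u : MIdx n → EuclideanSpace ℂ (Fin (momMatrixId n e y).rank),
      (∀ α β, mdeg α ≤ t → mdeg β ≤ t → inner ℂ (u α) (u β) = y α β) ∧
      Submodule.span ℂ (Set.range fun a : Idx n e => u a.1) = ⊤ := by
  obtain ⟨v, hv⟩ := psd_factor _ hM
  have r1 := rank_gram v _ hv
  let v' : Idx n e → EuclideanSpace ℂ (Idx n t) := fun a => v ⟨a.1, a.2.trans het⟩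
  have r2 := rank_gram v' (momMatrixId n e y) (fun a b => hv _ _)
  have hle : Submodule.span ℂ (Set.range v') ≤ Submodule.span ℂ (Set.range v) := by
    apply Submodule.span_mono
    rintro _ ⟨a, rfl⟩
    exact ⟨_, rfl⟩
  have heq := Submodule.eq_of_le_of_finrank_eq hle (by rw [← r1, ← r2, hrank])
  set V := Submodule.span ℂ (Set.range v) with hV
  let φ := ((stdOrthonormalBasis ℂ V).reindex (finCongr (r1.symm.trans hrank))).repr
  have hmem : ∀ a, v a ∈ V := fun a => Submodule.subset_span ⟨a, rfl⟩
  refine ⟨fun α => if h : mdeg α ≤ t then φ ⟨v ⟨α, h⟩, hmem _⟩ else 0, ?_, ?_⟩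
  · intro α β hα hβ
    simp only [hα, hβ, dif_pos, LinearIsometryEquiv.inner_map_map, Submodule.coe_inner]
    exact hv _ _
  · rw [eq_top_iff]
    intro x _
    rw [Submodule.mem_span_range_iff_exists_fun]
    have hx : ((φ.symm x : V) : EuclideanSpace ℂ (Idx n t)) ∈ Submodule.span ℂ (Set.range v') := by
      rw [heq]; exact (φ.symm x).2
    rw [Submodule.mem_span_range_iff_exists_fun] at hx
    obtain ⟨c, hc⟩ := hx
    refine ⟨c, ?_⟩
    have h2 : ∑ a : Idx n e, c a • (⟨v ⟨a.1, a.2.trans het⟩, hmem _⟩ : V) = φ.symm x := by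
      apply Subtype.ext
      rw [← hc]
      simp [v']
    have h3 := congrArg φ h2
    rw [LinearIsometryEquiv.apply_symm_apply, map_sum] at h3
    rw [← h3]
    refine Finset.sum_congr rfl fun a _ => ?_
    have : mdeg a.1 ≤ t := a.2.trans het
    simp only [this, dif_pos, map_smul]

lemma finsum_Idx {n l : ℕ} (F : MIdx n → ℂ) (h : ∀ α, F α ≠ 0 → mdeg α ≤ l) :
    ∑ᶠ α, F α = ∑ a : Idx n l, F a.1 := by
  have hinj : Function.Injective (fun a : Idx n l => a.1) := Subtype.val_injective
  rw [finsum_eq_sum_of_support_subset (s := Finset.univ.image (fun a : Idx n l => a.1))]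
  · rw [Finset.sum_image (fun a _ b _ hab => hinj hab)]
  · intro α hα
    simp only [Finset.coe_image, Finset.coe_univ, Set.image_univ]
    exact ⟨⟨α, h α hα⟩, rfl⟩

lemma finsum2_Idx {n l : ℕ} (F : MIdx n → MIdx n → ℂ)
    (h : ∀ α β, F α β ≠ 0 → mdeg α ≤ l ∧ mdeg β ≤ l) :
    ∑ᶠ α, ∑ᶠ β, F α β = ∑ a : Idx n l, ∑ b : Idx n l, F a.1 b.1 := by
  have h1 : ∀ α, ∑ᶠ β, F α β = ∑ b : Idx n l, F α b.1 :=
    fun α => finsum_Idx _ fun β hβ => (h α β hβ).2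
  simp only [h1]
  refine finsum_Idx _ fun α hα => ?_
  obtain ⟨b, _, hb⟩ := Finset.exists_ne_zero_of_sum_ne_zero hα
  exact (h _ _ hb).1

lemma psd_sum {ι : Type*} [Fintype ι] {M : Matrix ι ι ℂ} (hM : M.PosSemidef) (c : ι → ℂ) :
    0 ≤ ∑ a, ∑ b, star (c a) * M a b * c b := by
  have := hM.dotProduct_mulVec_nonneg c
  simpa [dotProduct, Matrix.mulVec, Finset.mul_sum, mul_assoc] using this

lemma inner_qform {ι H : Type*} [Fintype ι] [NormedAddCommGroup H] [InnerProductSpace ℂ H]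
    (c : ι → ℂ) (v : ι → H) :
    ((‖∑ a, c a • v a‖ ^ 2 : ℝ) : ℂ) = ∑ a, ∑ b, star (c a) * inner ℂ (v a) (v b) * c b := by
  have : ((‖∑ a, c a • v a‖ ^ 2 : ℝ) : ℂ) = inner ℂ (∑ a, c a • v a) (∑ a, c a • v a) := by
    rw [inner_self_eq_norm_sq_to_K]; norm_cast
  rw [this]
  simp only [sum_inner, inner_sum, inner_smul_left, inner_smul_right, Finset.mul_sum]
  rw [Finset.sum_comm]
  refine Finset.sum_congr rfl fun a _ => Finset.sum_congr rfl fun b _ => ?_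
  rw [← starRingEnd_apply]; ring

lemma momEntry_sphere {n : ℕ} (R : ℝ) (y : MIdx n → MIdx n → ℂ) (α β : MIdx n) :
    momEntry (spherePoly n R) y α β =
      (R ^ 2 : ℝ) * y α β - ∑ i, y (α + Pi.single i 1) (β + Pi.single i 1) := by
  have hsp : ∀ γ δ, spherePoly n R γ δ = (if γ = 0 ∧ δ = 0 then ((R ^ 2 : ℝ) : ℂ) else 0) -
      ∑ i, if γ = Pi.single i 1 ∧ δ = Pi.single i 1 then 1 else 0 := by
    intro γ δ
    unfold spherePoly
    by_cases h0 : γ = 0 ∧ δ = 0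
    · rw [if_pos h0, if_pos h0, Finset.sum_eq_zero, sub_zero]
      intro i _
      rw [if_neg]
      rintro ⟨h, -⟩
      rw [h0.1] at h
      have := congrFun h i
      simp at this
    · rw [if_neg h0, if_neg h0]
      split_ifs with h
      · obtain ⟨i, hi, hi'⟩ := h
        rw [Finset.sum_eq_single i]
        · simp [hi, hi']
        · intro j _ hj
          rw [if_neg]
          rintro ⟨h, -⟩
          rw [hi] at h
          have := congrFun h j
          simp [hj] at this
        · simp
      · rw [Finset.sum_eq_zero, sub_zero]
        intro i _
        rw [if_neg]
        exact fun hh => h ⟨i, hh⟩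
  unfold momEntry
  rw [finsum2_Idx (l := 1)]
  · simp only [hsp, sub_mul, Finset.sum_sub_distrib, Finset.sum_mul]
    have key : ∀ (γ₀ : MIdx n) (x : ℂ), mdeg γ₀ ≤ 1 → ∑ a : Idx n 1, ∑ b : Idx n 1,
        (if a.1 = γ₀ ∧ b.1 = γ₀ then x else 0) * y (α + a.1) (β + b.1) =
        x * y (α + γ₀) (β + γ₀) := by
      intro γ₀ x hγ
      have hne : ∀ b : Idx n 1, b ≠ ⟨γ₀, hγ⟩ → b.1 ≠ γ₀ := fun b hb h => hb (Subtype.ext h)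
      rw [Finset.sum_eq_single ⟨γ₀, hγ⟩, Finset.sum_eq_single ⟨γ₀, hγ⟩]
      · rw [if_pos ⟨rfl, rfl⟩]
      · intro b _ hb; rw [if_neg (fun h => hne b hb h.2), zero_mul]
      · intro h; exact (h (Finset.mem_univ _)).elim
      · intro b _ hb
        refine Finset.sum_eq_zero fun c _ => ?_
        rw [if_neg (fun h => hne b hb h.1), zero_mul]
      · intro h; exact (h (Finset.mem_univ _)).elim
    refine congrArg₂ (· - ·) ?_ ?_
    · have := key 0 ((R ^ 2 : ℝ) : ℂ) (by rw [mdeg_zero]; omega)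
      rw [add_zero, add_zero] at this
      exact this
    · have e : ∀ i, y (α + Pi.single i 1) (β + Pi.single i 1) = ∑ a : Idx n 1, ∑ b : Idx n 1,
        (if a.1 = Pi.single i 1 ∧ b.1 = Pi.single i 1 then (1 : ℂ) else 0) *
          y (α + a.1) (β + b.1) := fun i => by
        rw [key _ _ (mdeg_single i).le, one_mul]
      simp only [e]
      symm
      rw [Finset.sum_comm]
      refine Finset.sum_congr rfl fun a _ => ?_
      rw [Finset.sum_comm]
  · intro γ δ h
    have h1 := left_ne_zero_of_mul h
    unfold spherePoly at h1
    split_ifs at h1 with h2 h3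
    · simp [h2.1, h2.2, mdeg_zero]
    · obtain ⟨i, hi, hi'⟩ := h3
      simp [hi, hi', mdeg_single]
    · exact absurd rfl h1

lemma exists_atoms {n : ℕ} (hn : 1 < n) {t e : ℕ} (het : e ≤ t) (R : ℝ) (y : MIdx n → MIdx n → ℂ)
    (hM : (momMatrixId n (t + 1) y).PosSemidef)
    (hrank : (momMatrixId n (t + 1) y).rank = (momMatrixId n e y).rank)
    (hs : (momMatrix n t (spherePoly n R) y).PosSemidef)
    (hloc : ∀ i j : Fin n, i < j → (locMat3 n e y i j).PosSemidef) :
    ∃ ζ : Fin (momMatrixId n e y).rank → Fin n → ℂ, ∃ c : Fin (momMatrixId n e y).rank → ℂ,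
      (∀ α β, mdeg α ≤ t + 1 → mdeg β ≤ t + 1 →
        y α β = ∑ s, star (c s * mpow (ζ s) α) * (c s * mpow (ζ s) β)) ∧
      (∀ s, ∃ p : Idx n e → ℂ, ∀ r, (∑ a, p a * mpow (ζ r) a.1) * c r = if r = s then 1 else 0) := by
  obtain ⟨u, hu, hspan⟩ := exists_gns (by omega) y hM hrank
  have hex := atomic_rep hn het R u hspan (by
    intro c i
    have h := psd_sum hs c
    have e1 : ∑ a, ∑ b, star (c a) * momMatrix n t (spherePoly n R) y a b * c b =
        ((R ^ 2 * ‖∑ a, c a • u a.1‖ ^ 2 -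
          ∑ i, ‖∑ a, c a • u (a.1 + Pi.single i 1)‖ ^ 2 : ℝ) : ℂ) := by
      rw [Complex.ofReal_sub, Complex.ofReal_mul, Complex.ofReal_sum, inner_qform]
      simp only [inner_qform]
      rw [Finset.mul_sum, Finset.sum_comm (s := (Finset.univ : Finset (Fin n))),
        ← Finset.sum_sub_distrib]
      refine Finset.sum_congr rfl fun a _ => ?_
      rw [Finset.mul_sum, Finset.sum_comm (s := (Finset.univ : Finset (Fin n))),
        ← Finset.sum_sub_distrib]
      refine Finset.sum_congr rfl fun b _ => ?_
      have ha := a.2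
      have hb := b.2
      simp only [momMatrix, Matrix.of_apply, momEntry_sphere]
      rw [hu _ _ (by omega) (by omega)]
      have : ∀ i, inner ℂ (u (a.1 + Pi.single i 1)) (u (b.1 + Pi.single i 1)) =
          y (a.1 + Pi.single i 1) (b.1 + Pi.single i 1) := fun i =>
        hu _ _ (by rw [mdeg_add, mdeg_single]; omega) (by rw [mdeg_add, mdeg_single]; omega)
      simp only [this]
      rw [← Finset.sum_mul, ← Finset.mul_sum]
      ring
    rw [e1, Complex.zero_le_real] at h
    have := Finset.single_le_sum (f := fun i => ‖∑ a, c a • u (a.1 + Pi.single i 1)‖ ^ 2)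
      (fun j _ => by positivity) (Finset.mem_univ i)
    linarith) (by
    intro i j hij c
    have h := psd_sum (hloc i j hij) c
    convert h using 1
    refine Finset.sum_congr rfl fun a _ => Finset.sum_congr rfl fun b _ => ?_
    have ha := a.2.2
    have hb := b.2.2
    have hm : ∀ k : Fin 3, mdeg ((![0, Pi.single i 1, Pi.single j 1] : Fin 3 → MIdx n) k) ≤ 1 := by
      intro k
      fin_cases k
      · simp [mdeg_zero]
      · simp [mdeg_single]
      · simp [mdeg_single]
    have := hm a.1
    have := hm b.1
    rw [hu _ _ (by rw [mdeg_add]; omega) (by rw [mdeg_add]; omega)]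
    rfl)
  rw [finrank_euclideanSpace_fin] at hex
  obtain ⟨b, ζ, hb⟩ := hex
  refine ⟨ζ, fun s => inner ℂ (b s) (u 0), ?_, ?_⟩
  · intro α β hα hβ
    rw [← hu α β hα hβ, ← b.sum_inner_mul_inner]
    refine Finset.sum_congr rfl fun s _ => ?_
    rw [← inner_conj_symm, hb s α hα, hb s β hβ, ← starRingEnd_apply, mul_comm (mpow _ α),
      mul_comm (mpow _ β)]
  · intro s
    have hx : b s ∈ Submodule.span ℂ (Set.range fun a : Idx n e => u a.1) := by
      rw [hspan]; trivial
    rw [Submodule.mem_span_range_iff_exists_fun] at hx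
    obtain ⟨p, hp⟩ := hx
    refine ⟨p, fun r => ?_⟩
    rw [← b.inner_eq_ite r s, ← hp, inner_sum, Finset.sum_mul]
    refine Finset.sum_congr rfl fun a _ => ?_
    rw [inner_smul_right, hb r a.1 (a.2.trans (by omega)), mul_assoc]

lemma peval_eq {n l : ℕ} {φ : MIdx n → MIdx n → ℂ} (hφ : IsPolyDeg l φ) (z : Fin n → ℂ) :
    ((peval φ z : ℝ) : ℂ) =
      ∑ a : Idx n l, ∑ b : Idx n l, φ a.1 b.1 * star (mpow z a.1) * mpow z b.1 := by
  have h1 : peval φ z =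
      (∑ a : Idx n l, ∑ b : Idx n l, φ a.1 b.1 * star (mpow z a.1) * mpow z b.1).re := by
    unfold peval
    rw [finsum2_Idx (l := l)]
    · rfl
    · intro α β h
      exact hφ.1 α β (left_ne_zero_of_mul (left_ne_zero_of_mul h))
  rw [h1]
  refine Complex.conj_eq_iff_re.1 ?_
  simp only [map_sum, map_mul]
  rw [Finset.sum_comm]
  refine Finset.sum_congr rfl fun a _ => Finset.sum_congr rfl fun b _ => ?_
  rw [hφ.2, starRingEnd_apply, starRingEnd_apply, star_star]
  ring

lemma momEntry_atoms {n l t : ℕ} {ι : Type*} [Fintype ι] {φ : MIdx n → MIdx n → ℂ}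
    (hφ : IsPolyDeg l φ)
    (ζ : ι → Fin n → ℂ) (c : ι → ℂ) (y : MIdx n → MIdx n → ℂ)
    (hy : ∀ α β, mdeg α ≤ t → mdeg β ≤ t →
        y α β = ∑ s, star (c s * mpow (ζ s) α) * (c s * mpow (ζ s) β))
    (α β : MIdx n) (hα : mdeg α + l ≤ t) (hβ : mdeg β + l ≤ t) :
    momEntry φ y α β = ∑ s, star (c s * mpow (ζ s) α) * (c s * mpow (ζ s) β) *
      ((peval φ (ζ s) : ℝ) : ℂ) := by
  unfold momEntry
  rw [finsum2_Idx (l := l)]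
  · simp only [peval_eq hφ, Finset.mul_sum]
    rw [Finset.sum_comm (s := (Finset.univ : Finset ι))]
    refine Finset.sum_congr rfl fun a _ => ?_
    rw [Finset.sum_comm (s := (Finset.univ : Finset ι))]
    refine Finset.sum_congr rfl fun b _ => ?_
    have ha := a.2
    have hb := b.2
    rw [hy _ _ (by rw [mdeg_add]; omega) (by rw [mdeg_add]; omega), Finset.mul_sum]
    refine Finset.sum_congr rfl fun s _ => ?_
    simp only [mpow_add, star_mul']
    ring
  · intro γ δ h
    exact hφ.1 _ _ (left_ne_zero_of_mul h)

lemma Ly_eq {n : ℕ} (f y : MIdx n → MIdx n → ℂ) : Ly f y = (momEntry f y 0 0).re := by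
  simp [Ly, momEntry]

lemma dirac_feas {n m d k : ℕ} {f : MIdx n → MIdx n → ℂ}
    {g : Fin m → MIdx n → MIdx n → ℂ} {kk : Fin m → ℕ}
    (hf : IsPolyDeg k f) (hg : ∀ i, IsPolyDeg (kk i) (g i)) (z : Fin n → ℂ) (hz : z ∈ Kset g) :
    ∃ y, MomFeas n m d g kk y ∧ Ly f y = peval f z := by
  let y : MIdx n → MIdx n → ℂ := fun α β => star (mpow z α) * mpow z β
  have hy : ∀ {t : ℕ} (α β : MIdx n), mdeg α ≤ t → mdeg β ≤ t →
      y α β = ∑ _s : Unit, star ((1 : ℂ) * mpow z α) * ((1 : ℂ) * mpow z β) := by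
    intro t α β _ _; simp [y]
  have hent : ∀ {l : ℕ} {φ : MIdx n → MIdx n → ℂ}, IsPolyDeg l φ → ∀ α β,
      momEntry φ y α β = star (mpow z α) * mpow z β * ((peval φ z : ℝ) : ℂ) := by
    intro l φ hφ α β
    rw [momEntry_atoms (t := mdeg α + l + (mdeg β + l)) hφ (fun _ : Unit => z) (fun _ => 1) y hy
      α β (by omega) (by omega)]
    simp
  have hpsd : ∀ e, (momMatrixId n e y).PosSemidef := by
    intro e
    have := Matrix.posSemidef_vecMulVec_star_self (fun a : Idx n e => mpow z a.1)
    exact this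
  refine ⟨y, ⟨?_, ?_, hpsd d, ?_⟩, ?_⟩
  · intro α β _ _
    simp [y, mul_comm]
  · simp [y, mpow_zero]
  · intro i
    have h0 : (0 : ℂ) ≤ ((peval (g i) z : ℝ) : ℂ) := Complex.zero_le_real.2 (hz i)
    have : momMatrix n (d - kk i) (g i) y =
        ((peval (g i) z : ℝ) : ℂ) • momMatrixId n (d - kk i) y := by
      ext a b
      simp only [momMatrix, momMatrixId, Matrix.of_apply, Matrix.smul_apply, hent (hg i),
        smul_eq_mul, y]
      ring
    rw [this]
    exact (hpsd _).smul h0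
  · rw [Ly_eq, hent hf]
    simp [mpow_zero]

/-- Extraction of global solutions: if `y` is an optimal solution of the complex moment
relaxation of order `d`, `rank M_t(y) = rank M_{t−d_K}(y) = S` and the localizing block
matrices are positive semidefinite, then `ρ_d = f^opt` and the problem has at least `S`
global solutions. -/
theorem stmt13 (n m : ℕ) (hn : 1 < n)
    (f : MIdx n → MIdx n → ℂ) (k : ℕ)
    (g : Fin m → MIdx n → MIdx n → ℂ) (kk : Fin m → ℕ)
    (hf : IsPolyDeg k f) (hftop : HasTopDeg k f)
    (hg : ∀ i, IsPolyDeg (kk i) (g i)) (hgtop : ∀ i, HasTopDeg (kk i) (g i))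
    (dmin : ℕ) (hdmin : dmin = max k (Finset.univ.sup kk))
    (hK : IsCompact (Kset g))
    (R : ℝ) (hsphere : SphereAssumption n m g R)
    (d : ℕ) (hd : dmin ≤ d)
    (y : MIdx n → MIdx n → ℂ)
    (hyfeas : MomFeas n m d g kk y)
    (hyopt : ((Ly f y : ℝ) : EReal) = rhoMom n m d f g kk)
    (dK : ℕ) (hdK : dK = Finset.univ.sup kk)
    (t : ℕ) (ht1 : dmin ≤ t) (ht2 : t ≤ d)
    (hrank : (momMatrixId n t y).rank = (momMatrixId n (t - dK) y).rank)
    (hloc : ∀ i j : Fin n, i < j → (locMat3 n (t - dK) y i j).PosSemidef) :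
    rhoMom n m d f g kk = fOpt n m f g ∧
    ∃ zs : Fin ((momMatrixId n (t - dK) y).rank) → (Fin n → ℂ),
      Function.Injective zs ∧
      ∀ j, zs j ∈ Kset g ∧ ((peval f (zs j) : ℝ) : EReal) = fOpt n m f g := by
  have hdKle : dK ≤ dmin := by rw [hdmin, hdK]; exact le_max_right _ _
  have hkle : k ≤ dmin := by rw [hdmin]; exact le_max_left _ _
  have hkkle : ∀ i, kk i ≤ dK := fun i => by
    rw [hdK]; exact Finset.le_sup (f := kk) (Finset.mem_univ i)
  obtain ⟨hR, i₁, i₂, -, hg1, -⟩ := hsphere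
  have hk1 : kk i₁ = 1 := by
    apply le_antisymm
    · obtain ⟨α, β, hα, -, hne⟩ := hgtop i₁
      rw [hg1] at hne
      unfold spherePoly at hne
      rw [← hα]
      split_ifs at hne with h2 h3
      · rw [h2.1, mdeg_zero]; omega
      · obtain ⟨i, hi, -⟩ := h3
        rw [hi, mdeg_single]
      · exact absurd rfl hne
    · have hz : Fin n := ⟨0, by omega⟩
      have := ((hg i₁).1 (Pi.single hz 1) (Pi.single hz 1) (by
        rw [hg1]
        unfold spherePoly
        rw [if_neg, if_pos ⟨hz, rfl, rfl⟩]
        · norm_num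
        · rintro ⟨h, -⟩
          have := congrFun h hz
          simp at this)).1
      rwa [mdeg_single] at this
  have hdK1 : 1 ≤ dK := hk1 ▸ hkkle i₁
  obtain ⟨t', rfl⟩ : ∃ t', t = t' + 1 := ⟨t - 1, by omega⟩
  obtain ⟨hherm, hy0, hMd, hgd⟩ := hyfeas
  have hM : (momMatrixId n (t' + 1) y).PosSemidef :=
    hMd.submatrix (fun a : Idx n (t' + 1) => (⟨a.1, a.2.trans ht2⟩ : Idx n d))
  have hs : (momMatrix n t' (spherePoly n R) y).PosSemidef := by
    have := (hgd i₁).submatrix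
      (fun a : Idx n t' => (⟨a.1, a.2.trans (by omega)⟩ : Idx n (d - kk i₁)))
    rw [hg1] at this
    exact this
  obtain ⟨ζ, c, hyat, hint⟩ := exists_atoms hn (e := t' + 1 - dK) (by omega) R y hM hrank hs hloc
  have hcne : ∀ s, c s ≠ 0 := by
    intro s h
    obtain ⟨p, hp⟩ := hint s
    have := hp s
    simp [h] at this
  have hinj : Function.Injective ζ := by
    intro r s hrs
    by_contra hne
    obtain ⟨p, hp⟩ := hint s
    have h1 := hp s
    have h2 := hp r
    rw [if_neg hne, hrs] at h2
    rw [if_pos rfl] at h1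
    rcases mul_eq_zero.1 h2 with h | h
    · rw [h, zero_mul] at h1; exact zero_ne_one h1
    · exact hcne r h
  have hmemK : ∀ s, ζ s ∈ Kset g := by
    intro s i
    obtain ⟨p, hp⟩ := hint s
    have hki := hkkle i
    have hpsd := (hgd i).submatrix
      (fun a : Idx n (t' + 1 - dK) => (⟨a.1, a.2.trans (by omega)⟩ : Idx n (d - kk i)))
    have h := psd_sum hpsd p
    have e1 : ∑ a, ∑ b, star (p a) * ((momMatrix n (d - kk i) (g i) y).submatrix
        (fun a : Idx n (t' + 1 - dK) => (⟨a.1, a.2.trans (by omega)⟩ : Idx n (d - kk i)))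
        (fun a : Idx n (t' + 1 - dK) => (⟨a.1, a.2.trans (by omega)⟩ : Idx n (d - kk i)))) a b * p b
        = ∑ r, star ((∑ a, p a * mpow (ζ r) a.1) * c r) * ((∑ a, p a * mpow (ζ r) a.1) * c r) *
          ((peval (g i) (ζ r) : ℝ) : ℂ) := by
      simp only [star_mul', star_sum, Finset.sum_mul, Finset.mul_sum]
      rw [Finset.sum_comm (s := (Finset.univ : Finset (Fin _)))]
      rw [Finset.sum_comm]
      refine Finset.sum_congr rfl fun b _ => ?_
      rw [Finset.sum_comm (s := (Finset.univ : Finset (Fin _)))]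
      refine Finset.sum_congr rfl fun a _ => ?_
      have ha := a.2
      have hb := b.2
      have := momEntry_atoms (hg i) ζ c y hyat a.1 b.1 (by omega) (by omega)
      change star (p a) * momEntry (g i) y a.1 b.1 * p b = _
      rw [this, Finset.mul_sum, Finset.sum_mul]
      refine Finset.sum_congr rfl fun r _ => ?_
      simp only [star_mul']
      ring
    rw [e1] at h
    simp only [hp] at h
    rw [Finset.sum_eq_single s] at h
    · simpa using h
    · intro r _ hr; simp [hr]
    · simp
  set L := Ly f y with hL
  have hrho : rhoMom n m d f g kk ≤ fOpt n m f g := by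
    apply le_sInf
    rintro x ⟨z, hz, rfl⟩
    obtain ⟨y', hy', hyL⟩ := dirac_feas (d := d) hf hg z hz
    exact sInf_le ⟨y', hy', by rw [hyL]⟩
  have hfo : ∀ z ∈ Kset g, fOpt n m f g ≤ ((peval f z : ℝ) : EReal) := fun z hz =>
    sInf_le ⟨z, hz, rfl⟩
  have hLle : ∀ s, L ≤ peval f (ζ s) := by
    intro s
    have := hyopt.le.trans (hrho.trans (hfo _ (hmemK s)))
    exact_mod_cast this
  have hw1 : ∑ s, Complex.normSq (c s) = 1 := by
    have h := hyat 0 0 (by rw [mdeg_zero]; omega) (by rw [mdeg_zero]; omega)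
    rw [hy0] at h
    simp only [mpow_zero, mul_one, ← starRingEnd_apply, ← Complex.normSq_eq_conj_mul_self] at h
    exact_mod_cast h.symm
  have hLsum : L = ∑ s, Complex.normSq (c s) * peval f (ζ s) := by
    rw [hL, Ly_eq, momEntry_atoms hf ζ c y hyat 0 0 (by rw [mdeg_zero]; omega)
      (by rw [mdeg_zero]; omega)]
    simp only [mpow_zero, mul_one, ← starRingEnd_apply, ← Complex.normSq_eq_conj_mul_self]
    norm_cast
  have hzero : ∑ s, Complex.normSq (c s) * (peval f (ζ s) - L) = 0 := by
    simp only [mul_sub, Finset.sum_sub_distrib]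
    rw [← Finset.sum_mul, hw1, ← hLsum]; ring
  rw [Finset.sum_eq_zero_iff_of_nonneg
    (fun s _ => mul_nonneg (Complex.normSq_nonneg _) (sub_nonneg.2 (hLle s)))] at hzero
  have heq : ∀ s, peval f (ζ s) = L := by
    intro s
    have := hzero s (Finset.mem_univ _)
    rcases mul_eq_zero.1 this with h | h
    · exact absurd (Complex.normSq_eq_zero.1 h) (hcne s)
    · linarith
  obtain ⟨s₀, -, -⟩ : ∃ s ∈ Finset.univ, Complex.normSq (c s) ≠ 0 :=
    Finset.exists_ne_zero_of_sum_ne_zero (by rw [hw1]; exact one_ne_zero)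
  have hfin : rhoMom n m d f g kk = fOpt n m f g := by
    apply le_antisymm hrho
    have := hfo _ (hmemK s₀)
    rwa [heq, hyopt] at this
  refine ⟨hfin, ζ, hinj, fun j => ⟨hmemK j, ?_⟩⟩
  rw [heq, hyopt, hfin]
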